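/- arXiv:1605.03570 — 6 statements merged into one kernel-verified Lean document; each statement's English description precedes it below -/
import Mathlib

section
/- On the open set {(x,t) : t > 0, |x| < R(t)} where it is positive, the Barenblatt–Pattle function u is infinitely differentiable and satisfies the porous medium equation ∂u/∂t (x,t) = div_x ( u(x,t)^m ∇_x u(x,t) ), equivalently ∂u/∂t = (1/(m+1)) Δ_x (u^{m+1}). -/
open Real Topology

theorem eventually_one_sub_mul_norm_sq_pos {E : Type*} [NormedAddCommGroup E]
    (c : ℝ) {x : E} (hx : 0 < 1 - c * ‖x‖ ^ 2) :
    ∀ᶠ y in 𝓝 x, 0 < 1 - c * ‖y‖ ^ 2 :=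
  (by fun_prop : Continuous fun y : E => 1 - c * ‖y‖ ^ 2).continuousAt.eventually_const_lt hx

section Profile

variable {E : Type*} [NormedAddCommGroup E] [InnerProductSpace ℝ E]

theorem hasFDerivAt_const_mul_one_sub_mul_norm_sq_rpow (b c a : ℝ) {y : E}
    (hy : 0 < 1 - c * ‖y‖ ^ 2) :
    HasFDerivAt (fun z : E => b * (1 - c * ‖z‖ ^ 2) ^ a)
      ((-(2 * c * a * b) * (1 - c * ‖y‖ ^ 2) ^ (a - 1)) • innerSL ℝ y) y := by
  have h1 := ((((hasStrictFDerivAt_norm_sq y).hasFDerivAt.const_mul c).const_sub 1).rpow_const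
    (p := a) (Or.inl hy.ne')).const_mul b
  refine h1.congr_fderiv ?_
  ext v
  simp
  ring

theorem hasFDerivAt_const_mul_one_sub_mul_norm_sq_rpow_smul (k c a : ℝ) {x : E}
    (hx : 0 < 1 - c * ‖x‖ ^ 2) :
    HasFDerivAt (fun y : E => (k * (1 - c * ‖y‖ ^ 2) ^ a) • y)
      ((k * (1 - c * ‖x‖ ^ 2) ^ a) • ContinuousLinearMap.id ℝ E +
        ((-(2 * c * a * k) * (1 - c * ‖x‖ ^ 2) ^ (a - 1)) • innerSL ℝ x).smulRight x) x :=
  (hasFDerivAt_const_mul_one_sub_mul_norm_sq_rpow k c a hx).smul (hasFDerivAt_id x)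

end Profile

/-- The divergence of the radial field `k (1 - c ‖y‖²) ^ a • y`. -/
theorem sum_fderiv_one_sub_mul_norm_sq_rpow_smul {d : ℕ} (k c a : ℝ)
    {x : EuclideanSpace ℝ (Fin d)} (hx : 0 < 1 - c * ‖x‖ ^ 2) :
    ∑ i : Fin d, (fderiv ℝ (fun y : EuclideanSpace ℝ (Fin d) =>
        (k * (1 - c * ‖y‖ ^ 2) ^ a) • y) x (EuclideanSpace.single i 1)) i =
      k * (d * (1 - c * ‖x‖ ^ 2) ^ a - 2 * c * a * ‖x‖ ^ 2 * (1 - c * ‖x‖ ^ 2) ^ (a - 1)) := by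
  rw [(hasFDerivAt_const_mul_one_sub_mul_norm_sq_rpow_smul k c a hx).fderiv]
  simp only [add_apply, smul_apply,
    ContinuousLinearMap.id_apply, ContinuousLinearMap.smulRight_apply, innerSL_apply_apply,
    PiLp.add_apply, PiLp.smul_apply, smul_eq_mul, EuclideanSpace.inner_single_right,
    PiLp.single_apply, if_true]
  simp only [mul_one, one_mul, conj_trivial, Finset.sum_add_distrib, Finset.sum_const,
    Finset.card_univ, Fintype.card_fin, nsmul_eq_mul]
  rw [EuclideanSpace.real_norm_sq_eq x]
  simp only [mul_assoc, ← Finset.mul_sum, ← pow_two]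
  ring

section Slice

variable {d : ℕ} {m A c : ℝ} {v : EuclideanSpace ℝ (Fin d) → ℝ}

theorem flux_eventuallyEq (hm : 0 < m) (hA : 0 < A)
    (hv : ∀ y, 0 < 1 - c * ‖y‖ ^ 2 → v y = A * (1 - c * ‖y‖ ^ 2) ^ (1 / m))
    {x : EuclideanSpace ℝ (Fin d)} (hx : 0 < 1 - c * ‖x‖ ^ 2) :
    (fun y => v y ^ m • gradient v y) =ᶠ[𝓝 x]
      fun y => (-(2 * c / m * A ^ (m + 1)) * (1 - c * ‖y‖ ^ 2) ^ (1 / m)) • y := by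
  filter_upwards [eventually_one_sub_mul_norm_sq_pos c hx] with y hy
  have hvy : v =ᶠ[𝓝 y] fun z => A * (1 - c * ‖z‖ ^ 2) ^ (1 / m) :=
    (eventually_one_sub_mul_norm_sq_pos c hy).mono hv
  have hg : HasGradientAt v
      ((-(2 * c * (1 / m) * A) * (1 - c * ‖y‖ ^ 2) ^ (1 / m - 1)) • y) y := by
    rw [hasGradientAt_iff_hasFDerivAt]
    refine ((hasFDerivAt_const_mul_one_sub_mul_norm_sq_rpow A c (1 / m) hy).congr_of_eventuallyEq
      hvy).congr_fderiv ?_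
    ext w
    simp
  rw [hg.gradient, hv y hy, smul_smul, mul_rpow hA.le (by positivity), ← rpow_mul hy.le,
    one_div_mul_cancel hm.ne', rpow_one, rpow_add_one hA.ne', rpow_sub_one hy.ne']
  congr 1
  field_simp

theorem fderiv_rpow_eventuallyEq (hm : 0 < m) (hA : 0 < A)
    (hv : ∀ y, 0 < 1 - c * ‖y‖ ^ 2 → v y = A * (1 - c * ‖y‖ ^ 2) ^ (1 / m))
    {x : EuclideanSpace ℝ (Fin d)} (hx : 0 < 1 - c * ‖x‖ ^ 2) (i : Fin d) :
    (fun y => fderiv ℝ (fun z => v z ^ (m + 1)) y (EuclideanSpace.single i 1)) =ᶠ[𝓝 x]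
      fun y => (m + 1) *
        ((-(2 * c / m * A ^ (m + 1)) * (1 - c * ‖y‖ ^ 2) ^ (1 / m)) • y) i := by
  filter_upwards [eventually_one_sub_mul_norm_sq_pos c hx] with y hy
  have hvy : (fun z => v z ^ (m + 1)) =ᶠ[𝓝 y]
      fun z => A ^ (m + 1) * (1 - c * ‖z‖ ^ 2) ^ (1 / m * (m + 1)) := by
    filter_upwards [eventually_one_sub_mul_norm_sq_pos c hy] with z hz
    rw [hv z hz, mul_rpow hA.le (by positivity), ← rpow_mul hz.le]
  rw [((hasFDerivAt_const_mul_one_sub_mul_norm_sq_rpow (A ^ (m + 1)) c _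
    hy).congr_of_eventuallyEq hvy).fderiv]
  have he : 1 / m * (m + 1) - 1 = 1 / m := by field_simp; ring
  rw [he]
  simp [EuclideanSpace.inner_single_right]
  field_simp

theorem sum_fderiv_flux_eq_laplacian (hm : 0 < m) (hA : 0 < A)
    (hv : ∀ y, 0 < 1 - c * ‖y‖ ^ 2 → v y = A * (1 - c * ‖y‖ ^ 2) ^ (1 / m))
    {x : EuclideanSpace ℝ (Fin d)} (hx : 0 < 1 - c * ‖x‖ ^ 2) :
    ∑ i : Fin d, (fderiv ℝ (fun y => v y ^ m • gradient v y) x (EuclideanSpace.single i 1)) i =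
      (1 / (m + 1)) * ∑ i : Fin d,
        fderiv ℝ (fun y => fderiv ℝ (fun z => v z ^ (m + 1)) y (EuclideanSpace.single i 1)) x
          (EuclideanSpace.single i 1) := by
  rw [Finset.mul_sum]
  refine Finset.sum_congr rfl fun i _ => ?_
  have hF := hasFDerivAt_const_mul_one_sub_mul_norm_sq_rpow_smul
    (-(2 * c / m * A ^ (m + 1))) c (1 / m) hx
  have hFi := ((EuclideanSpace.proj (𝕜 := ℝ) i).hasFDerivAt.comp x hF).const_mul (m + 1)
  rw [(flux_eventuallyEq hm hA hv hx).fderiv_eq, hF.fderiv,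
    (hFi.congr_of_eventuallyEq (fderiv_rpow_eventuallyEq hm hA hv hx i)).fderiv]
  have : m + 1 ≠ 0 := by positivity
  simp
  field_simp

end Slice

theorem hasDerivAt_div_rpow {τ t : ℝ} (hτ : 0 < τ) (ht : 0 < t) {n : ℝ} (hn : n ≠ 0) :
    HasDerivAt (fun s => (s / τ) ^ (1 / n)) ((t / τ) ^ (1 / n) / (n * t)) t := by
  have hpos : 0 < t / τ := div_pos ht hτ
  refine (((hasDerivAt_id' t).div_const τ).rpow_const (p := 1 / n)
    (Or.inl hpos.ne')).congr_deriv ?_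
  rw [rpow_sub_one hpos.ne']
  field_simp

/-- On the open set `{(x,t) : t > 0, ‖x‖ < R t}` where it is positive,
the Barenblatt–Pattle function `u` is infinitely differentiable and satisfies the
porous medium equation `∂u/∂t = div_x (u^m ∇_x u)`, equivalently
`∂u/∂t = (1/(m+1)) Δ_x (u^(m+1))`. -/
theorem barenblatt_smooth_and_solves_PME
    (d : ℕ) (hd : 1 ≤ d) (m r₀ : ℝ) (hm : 1 ≤ m) (hr : 0 < r₀)
    (t₀ : ℝ) (ht₀ : t₀ = r₀ ^ 2 * m / (2 * (2 + (d : ℝ) * m)))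
    (lam R : ℝ → ℝ)
    (hlam : ∀ t, lam t = (t / t₀) ^ ((1 : ℝ) / (2 + (d : ℝ) * m)))
    (hR : ∀ t, R t = r₀ * lam t)
    (u : EuclideanSpace ℝ (Fin d) → ℝ → ℝ)
    (hu : ∀ x t, u x t
      = (lam t) ^ (-(d : ℝ)) * (max 0 (1 - (‖x‖ / R t) ^ 2)) ^ (1 / m)) :
    ContDiffOn ℝ (⊤ : ℕ∞) (fun p : EuclideanSpace ℝ (Fin d) × ℝ => u p.1 p.2)
      {p : EuclideanSpace ℝ (Fin d) × ℝ | 0 < p.2 ∧ ‖p.1‖ < R p.2} ∧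
    ∀ (x : EuclideanSpace ℝ (Fin d)) (t : ℝ), 0 < t → ‖x‖ < R t →
      HasDerivAt (fun s => u x s)
        (∑ i : Fin d,
          (fderiv ℝ (fun y => (u y t) ^ m • gradient (fun y' => u y' t) y) x
            (EuclideanSpace.single i 1)) i) t ∧
      (∑ i : Fin d,
          (fderiv ℝ (fun y => (u y t) ^ m • gradient (fun y' => u y' t) y) x
            (EuclideanSpace.single i 1)) i)
        = (1 / (m + 1)) * ∑ i : Fin d,
            fderiv ℝ (fun y => fderiv ℝ (fun y' => (u y' t) ^ (m + 1)) y
              (EuclideanSpace.single i 1)) x (EuclideanSpace.single i 1) := by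
  have hm0 : 0 < m := by linarith
  have hn : 0 < 2 + (d : ℝ) * m := by positivity
  have ht₀pos : 0 < t₀ := by rw [ht₀]; positivity
  have hlampos : ∀ t, 0 < t → 0 < lam t := fun t ht => by
    rw [hlam]; exact rpow_pos_of_pos (div_pos ht ht₀pos) _
  have hsq : ∀ (x : EuclideanSpace ℝ (Fin d)) t,
      1 - (‖x‖ / R t) ^ 2 = 1 - (r₀ ^ 2 * lam t ^ 2)⁻¹ * ‖x‖ ^ 2 := fun x t => by
    rw [hR, div_pow, mul_pow, div_eq_inv_mul]
  have hpos : ∀ (x : EuclideanSpace ℝ (Fin d)) t, 0 < t → ‖x‖ < R t →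
      0 < 1 - (r₀ ^ 2 * lam t ^ 2)⁻¹ * ‖x‖ ^ 2 := fun x t ht hx => by
    rw [← hsq, sub_pos, sq_lt_one_iff₀ (div_nonneg (norm_nonneg x) ((norm_nonneg x).trans hx.le))]
    exact (div_lt_one ((norm_nonneg x).trans_lt hx)).2 hx
  have huform : ∀ (x : EuclideanSpace ℝ (Fin d)) t,
      0 < 1 - (r₀ ^ 2 * lam t ^ 2)⁻¹ * ‖x‖ ^ 2 →
      u x t = lam t ^ (-(d : ℝ)) * (1 - (r₀ ^ 2 * lam t ^ 2)⁻¹ * ‖x‖ ^ 2) ^ (1 / m) :=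
    fun x t h => by rw [hu, hsq, max_eq_right h.le]
  refine ⟨?_, fun x t ht hx => ?_⟩
  · intro p hp
    have hl : ContDiffAt ℝ (⊤ : ℕ∞)
        (fun p : EuclideanSpace ℝ (Fin d) × ℝ => lam p.2) p := by
      simp only [hlam]
      exact (contDiffAt_snd.div_const t₀).rpow_const_of_ne (div_pos hp.1 ht₀pos).ne'
    have hlp := hlampos _ hp.1
    have hP : ContDiffAt ℝ (⊤ : ℕ∞) (fun p : EuclideanSpace ℝ (Fin d) × ℝ =>
        1 - (r₀ ^ 2 * lam p.2 ^ 2)⁻¹ * ‖p.1‖ ^ 2) p :=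
      contDiffAt_const.sub
        (((contDiffAt_const.mul (hl.pow 2)).inv (by positivity)).mul (contDiffAt_fst.norm_sq ℝ))
    exact ((hl.rpow_const_of_ne hlp.ne').mul
      (hP.rpow_const_of_ne (hpos _ _ hp.1 hp.2).ne')).contDiffWithinAt.congr
        (fun q hq => huform _ _ (hpos _ _ hq.1 hq.2)) (huform _ _ (hpos _ _ hp.1 hp.2))
  · have hP := hpos x t ht hx
    have hL := hlampos t ht
    have hA : 0 < lam t ^ (-(d : ℝ)) := rpow_pos_of_pos hL _
    refine ⟨?_, sum_fderiv_flux_eq_laplacian hm0 hA (fun y hy => huform y t hy) hP⟩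
    rw [Finset.sum_congr rfl fun i _ => by
      rw [(flux_eventuallyEq hm0 hA (fun y hy => huform y t hy) hP).fderiv_eq],
      sum_fderiv_one_sub_mul_norm_sq_rpow_smul _ _ _ hP]
    have hl : HasDerivAt lam (lam t / ((2 + (d : ℝ) * m) * t)) t := by
      have := hasDerivAt_div_rpow ht₀pos ht hn.ne'
      rwa [← hlam, ← funext hlam] at this
    have hc := ((((hl.pow 2).const_mul (r₀ ^ 2)).inv
      (mul_pos (pow_pos hr 2) (pow_pos hL 2)).ne').mul_const (‖x‖ ^ 2)).const_sub 1
    have hderiv := (hl.rpow_const (p := -(d : ℝ)) (Or.inl hL.ne')).mul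
      (hc.rpow_const (p := 1 / m) (Or.inl hP.ne'))
    have hev : (fun s => u x s) =ᶠ[𝓝 t] fun s =>
        lam s ^ (-(d : ℝ)) * (1 - (r₀ ^ 2 * lam s ^ 2)⁻¹ * ‖x‖ ^ 2) ^ (1 / m) :=
      (hc.continuousAt.eventually_const_lt hP).mono fun s hs => huform x s hs
    refine (hderiv.congr_of_eventuallyEq hev).congr_deriv ?_
    have hlt : lam t ^ (2 + (d : ℝ) * m) = t / t₀ := by
      rw [hlam, ← rpow_mul (div_pos ht ht₀pos).le, one_div_mul_cancel hn.ne', rpow_one]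
    have htime : t = lam t ^ 2 * lam t ^ ((d : ℝ) * m) * t₀ := by
      rw [← rpow_natCast (lam t) 2, ← rpow_add hL, Nat.cast_ofNat, hlt,
        div_mul_cancel₀ _ ht₀pos.ne']
    have hAm : (lam t ^ (-(d : ℝ))) ^ m = (lam t ^ ((d : ℝ) * m))⁻¹ := by
      rw [← rpow_mul hL.le, neg_mul, rpow_neg hL.le]
    have hrate : (2 + (d : ℝ) * m) * t
        = lam t ^ 2 * lam t ^ ((d : ℝ) * m) * (r₀ ^ 2 * m / 2) := by
      conv_lhs => rw [htime, ht₀]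
      field_simp
    have hD : 0 < lam t ^ ((d : ℝ) * m) := rpow_pos_of_pos hL _
    simp only [Pi.pow_apply, rpow_add_one hA.ne', hAm, hrate, rpow_sub_one hL.ne']
    generalize (1 - (r₀ ^ 2 * lam t ^ 2)⁻¹ * ‖x‖ ^ 2) ^ (1 / m) = Q
    generalize (1 - (r₀ ^ 2 * lam t ^ 2)⁻¹ * ‖x‖ ^ 2) ^ (1 / m - 1) = Q'
    field_simp
    ring
end

section
/- For every t > 0 and every x with 0 < ‖x‖ < R(t), the Barenblatt–Pattle function u(·,t) is differentiable at x with spatial gradient ∇_x u(x,t) = −(2/(m r₀²)) · λ(t)^{−d−2} · (1 − (‖x‖/R(t))²)^{1/m − 1} · x. -/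
open Real

/-- Gradient of the truncated power profile `y ↦ (1 - (‖y‖ / ρ)²)₊ ^ p` inside the ball of
radius `ρ`. -/
theorem hasGradientAt_max_zero_one_sub_norm_div_sq_rpow {E : Type*} [NormedAddCommGroup E]
    [InnerProductSpace ℝ E] [CompleteSpace E] (ρ p : ℝ) {x : E} (hx : ‖x‖ < ρ) :
    HasGradientAt (fun y : E => (max 0 (1 - (‖y‖ / ρ) ^ 2)) ^ p)
      ((-(2 * p / ρ ^ 2) * (1 - (‖x‖ / ρ) ^ 2) ^ (p - 1)) • x) x := by
  have hρ : 0 < ρ := (norm_nonneg x).trans_lt hx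
  have hpos : 0 < 1 - (‖x‖ / ρ) ^ 2 := by
    have h1 : ‖x‖ / ρ < 1 := (div_lt_one hρ).2 hx
    have h0 : 0 ≤ ‖x‖ / ρ := by positivity
    nlinarith
  have hsq : HasFDerivAt (fun y : E => 1 - (ρ ^ 2)⁻¹ * ‖y‖ ^ 2)
      (-((ρ ^ 2)⁻¹ • (2 • innerSL ℝ x))) x :=
    ((hasStrictFDerivAt_norm_sq x).hasFDerivAt.const_mul _).const_sub 1
  have heq : ∀ y : E, 1 - (ρ ^ 2)⁻¹ * ‖y‖ ^ 2 = 1 - (‖y‖ / ρ) ^ 2 := fun y => by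
    rw [div_pow, div_eq_inv_mul]
  simp only [heq] at hsq
  have hev : (fun y : E => (max 0 (1 - (‖y‖ / ρ) ^ 2)) ^ p) =ᶠ[nhds x]
      fun y => (1 - (‖y‖ / ρ) ^ 2) ^ p := by
    filter_upwards [hsq.continuousAt.eventually (lt_mem_nhds hpos)] with y hy
    rw [max_eq_right hy.le]
  rw [hasGradientAt_iff_hasFDerivAt]
  refine ((hsq.rpow_const (Or.inl hpos.ne')).congr_of_eventuallyEq hev).congr_fderiv ?_
  ext v
  simp
  ring

/-- For every `t > 0` and every `x` with `0 < ‖x‖ < R t`, the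
Barenblatt–Pattle function `u(·,t)` is differentiable at `x` with spatial gradient
`∇_x u(x,t) = −(2/(m r₀²)) λ(t)^(−d−2) (1 − (‖x‖/R(t))²)^(1/m − 1) • x`. -/
theorem barenblatt_gradient
    (d : ℕ) (hd : 1 ≤ d) (m r₀ : ℝ) (hm : 1 ≤ m) (hr : 0 < r₀)
    (t₀ : ℝ) (ht₀ : t₀ = r₀ ^ 2 * m / (2 * (2 + (d : ℝ) * m)))
    (lam R : ℝ → ℝ)
    (hlam : ∀ t, lam t = (t / t₀) ^ ((1 : ℝ) / (2 + (d : ℝ) * m)))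
    (hR : ∀ t, R t = r₀ * lam t)
    (u : EuclideanSpace ℝ (Fin d) → ℝ → ℝ)
    (hu : ∀ x t, u x t
      = (lam t) ^ (-(d : ℝ)) * (max 0 (1 - (‖x‖ / R t) ^ 2)) ^ (1 / m)) :
    ∀ (t : ℝ) (x : EuclideanSpace ℝ (Fin d)), 0 < t → 0 < ‖x‖ → ‖x‖ < R t →
      HasGradientAt (fun y => u y t)
        ((-(2 / (m * r₀ ^ 2)) * (lam t) ^ (-(d : ℝ) - 2)
          * (1 - (‖x‖ / R t) ^ 2) ^ (1 / m - 1)) • x) x := by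
  intro t x ht hx hxR
  have hR0 : 0 < R t := hx.trans hxR
  have hl : 0 < lam t := by
    rw [hR] at hR0
    exact pos_of_mul_pos_right hR0 hr.le
  have hm0 : m ≠ 0 := by positivity
  simp only [hu]
  rw [hasGradientAt_iff_hasFDerivAt]
  refine ((hasGradientAt_max_zero_one_sub_norm_div_sq_rpow (R t) (1 / m)
    hxR).hasFDerivAt.const_mul (lam t ^ (-(d : ℝ)))).congr_fderiv ?_
  rw [← map_smul, smul_smul]
  congr 2
  rw [Real.rpow_sub hl (-(d : ℝ)) 2, Real.rpow_two, hR]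
  field_simp
end

section
/- For all 0 < a < b there exists a constant L such that |u(x,t)^m − u(x,s)^m| ≤ L |t − s| for all x ∈ ℝ^d and all s, t ∈ [a,b]; that is, the m-th power of the Barenblatt–Pattle function is Lipschitz continuous in time on compact subintervals of (0,∞), uniformly in the space variable. -/
open Real

/-- A positive `C¹` function of time on `[a,b]`, raised to any real power, is Lipschitz there. -/
lemma ContDiffOn.exists_abs_rpow_sub_le {f : ℝ → ℝ} {a b : ℝ}
    (hf : ContDiffOn ℝ 1 f (Set.Icc a b)) (hpos : ∀ t ∈ Set.Icc a b, 0 < f t) (e : ℝ) :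
    ∃ K : ℝ, 0 ≤ K ∧ ∀ s ∈ Set.Icc a b, ∀ t ∈ Set.Icc a b, |f t ^ e - f s ^ e| ≤ K * |t - s| := by
  have h : ContDiffOn ℝ 1 (fun t => f t ^ e) (Set.Icc a b) :=
    hf.rpow_const_of_ne fun t ht => (hpos t ht).ne'
  obtain ⟨K, hK⟩ := h.exists_lipschitzOnWith one_ne_zero (convex_Icc a b) isCompact_Icc
  exact ⟨K, K.2, fun s hs t ht => by simpa [Real.dist_eq] using hK.dist_le_mul t ht s hs⟩

/-- If `A` and `B` are Lipschitz, then `max 0 (A - c * B)` is Lipschitz uniformly in `c ∈ [0,C]`. -/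
lemma abs_max_zero_sub_mul_le {A A' B B' c C K M δ : ℝ} (hc : 0 ≤ c) (hcC : c ≤ C)
    (hA : |A - A'| ≤ K * δ) (hB : |B - B'| ≤ M * δ) :
    |max 0 (A - c * B) - max 0 (A' - c * B')| ≤ (K + C * M) * δ := by
  calc |max 0 (A - c * B) - max 0 (A' - c * B')|
      ≤ |(A - c * B) - (A' - c * B')| := by
        rw [max_comm 0, max_comm 0]
        exact abs_max_sub_max_le_abs _ _ _
    _ = |(A - A') - c * (B - B')| := by ring_nf
    _ ≤ |A - A'| + |c * (B - B')| := abs_sub _ _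
    _ = |A - A'| + c * |B - B'| := by rw [abs_mul, abs_of_nonneg hc]
    _ ≤ K * δ + C * (M * δ) := by
        have hC : 0 ≤ C := hc.trans hcC
        gcongr
    _ = (K + C * M) * δ := by ring

/-- The `m`-th power of a Barenblatt profile at scale `l`, written without the root. -/
lemma barenblatt_rpow_eq {l r₀ m D y : ℝ} (hl : 0 < l) (hm : m ≠ 0) :
    (l ^ (-D) * (max 0 (1 - (y / (r₀ * l)) ^ 2)) ^ (1 / m)) ^ m
      = max 0 (l ^ (-D * m) - (y / r₀) ^ 2 * l ^ (-D * m - 2)) := by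
  have h2 : l ^ (-D * m - 2) = l ^ (-D * m) / l ^ 2 := by
    rw [Real.rpow_sub hl, Real.rpow_two]
  rw [Real.mul_rpow (by positivity) (by positivity), ← Real.rpow_mul hl.le,
    ← Real.rpow_mul (le_max_left _ _), one_div_mul_cancel hm, Real.rpow_one,
    mul_max_of_nonneg _ _ (by positivity), mul_zero, h2]
  congr 1
  rw [← div_div, div_pow _ l]
  ring

/-- For all `0 < a < b` there exists a constant `L` such that
`|u(x,t)^m − u(x,s)^m| ≤ L |t − s|` for all `x ∈ ℝ^d` and all `s, t ∈ [a,b]`;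
that is, the `m`-th power of the Barenblatt–Pattle function is Lipschitz continuous
in time on compact subintervals of `(0,∞)`, uniformly in the space variable. -/
theorem barenblatt_pressure_time_lipschitz
    (d : ℕ) (hd : 1 ≤ d) (m r₀ : ℝ) (hm : 1 ≤ m) (hr : 0 < r₀)
    (t₀ : ℝ) (ht₀ : t₀ = r₀ ^ 2 * m / (2 * (2 + (d : ℝ) * m)))
    (lam R : ℝ → ℝ)
    (hlam : ∀ t, lam t = (t / t₀) ^ ((1 : ℝ) / (2 + (d : ℝ) * m)))
    (hR : ∀ t, R t = r₀ * lam t)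
    (u : EuclideanSpace ℝ (Fin d) → ℝ → ℝ)
    (hu : ∀ x t, u x t
      = (lam t) ^ (-(d : ℝ)) * (max 0 (1 - (‖x‖ / R t) ^ 2)) ^ (1 / m)) :
    ∀ a b : ℝ, 0 < a → a < b →
      ∃ L : ℝ, ∀ (x : EuclideanSpace ℝ (Fin d)) (s t : ℝ),
        s ∈ Set.Icc a b → t ∈ Set.Icc a b →
          |u x t ^ m - u x s ^ m| ≤ L * |t - s| := by
  intro a b ha hab
  have hm0 : 0 < m := by linarith
  have ht₀pos : 0 < t₀ := by rw [ht₀]; positivity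
  have hquot : ∀ t ∈ Set.Icc a b, 0 < t / t₀ := fun t ht => div_pos (ha.trans_le ht.1) ht₀pos
  have hpos : ∀ t ∈ Set.Icc a b, 0 < lam t := fun t ht => by
    rw [hlam]; exact Real.rpow_pos_of_pos (hquot t ht) _
  have hle : ∀ t ∈ Set.Icc a b, lam t ≤ lam b := fun t ht => by
    rw [hlam, hlam]
    exact Real.rpow_le_rpow (hquot t ht).le (by gcongr; exact ht.2) (by positivity)
  have hsmooth : ContDiffOn ℝ 1 lam (Set.Icc a b) := by
    rw [funext hlam]
    exact (contDiff_id.div_const t₀).contDiffOn.rpow_const_of_ne fun t ht => (hquot t ht).ne'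
  obtain ⟨K, hK0, hK⟩ := hsmooth.exists_abs_rpow_sub_le hpos (-(d : ℝ) * m)
  obtain ⟨M, hM0, hM⟩ := hsmooth.exists_abs_rpow_sub_le hpos (-(d : ℝ) * m - 2)
  have hform : ∀ x, ∀ t ∈ Set.Icc a b, u x t ^ m = max 0
      (lam t ^ (-(d : ℝ) * m) - (‖x‖ / r₀) ^ 2 * lam t ^ (-(d : ℝ) * m - 2)) := fun x t ht => by
    rw [hu, hR, barenblatt_rpow_eq (hpos t ht) hm0.ne']
  refine ⟨K + lam b ^ 2 * M, fun x s t hs ht => ?_⟩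
  rcases le_or_gt ((‖x‖ / r₀) ^ 2) (lam b ^ 2) with hx | hx
  · rw [hform x t ht, hform x s hs]
    exact abs_max_zero_sub_mul_le (sq_nonneg _) hx (hK s hs t ht) (hM s hs t ht)
  · have hzero : ∀ t ∈ Set.Icc a b, u x t ^ m = 0 := fun t ht => by
      have hl := hpos t ht
      rw [hform x t ht, max_eq_left]
      have hsplit : lam t ^ (-(d : ℝ) * m) = lam t ^ 2 * lam t ^ (-(d : ℝ) * m - 2) := by
        rw [← Real.rpow_two, ← Real.rpow_add hl]
        ring_nf
      rw [hsplit, sub_nonpos]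
      exact mul_le_mul_of_nonneg_right
        ((pow_le_pow_left₀ hl.le (hle t ht) 2).trans hx.le) (by positivity)
    rw [hzero t ht, hzero s hs, sub_self, abs_zero]
    positivity
end

section
/- The Barenblatt–Pattle solution satisfies Darcy's law at its free boundary: for every t > 0, the free boundary radius R is differentiable at t with R'(t) = 2/(m r₀ λ(t)^{dm+1}), and for every unit vector e ∈ ℝ^d, the radial derivative of the pressure, i.e. the function r ↦ (d/dr)( u(r e, t)^m / m ) defined for 0 < r < R(t), tends to −R'(t) as r → R(t)⁻. -/
open Real Topology

/-- The profile `t ↦ (t / t₀) ^ (1 / k)` solves `y' = 1 / (k t₀ y ^ (k - 1))`. -/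
lemma hasDerivAt_div_rpow_one_div {k t₀ t : ℝ} (hk : 0 < k) (ht₀ : 0 < t₀) (ht : 0 < t) :
    HasDerivAt (fun s : ℝ => (s / t₀) ^ (1 / k))
      (1 / (k * t₀ * ((t / t₀) ^ (1 / k)) ^ (k - 1))) t := by
  have hq : 0 < t / t₀ := div_pos ht ht₀
  have h := ((hasDerivAt_id t).div_const t₀).rpow_const (p := 1 / k) (Or.inl hq.ne')
  refine h.congr_deriv ?_
  have hexp : 1 / k - 1 = -(1 / k * (k - 1)) := by field_simp; ring
  simp only [id_eq]
  rw [← Real.rpow_mul hq.le, hexp, Real.rpow_neg hq.le]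
  field_simp

/-- Along a ray, the pressure of a Barenblatt-type profile of amplitude `a` and support radius `ρ`
has radial derivative tending to `-2 a ^ m / (m ρ)` at the edge of the support. -/
lemma tendsto_deriv_pressure_nhdsLT {E : Type*} [NormedAddCommGroup E] [NormedSpace ℝ E]
    {m a ρ : ℝ} (hm : m ≠ 0) (ha : 0 ≤ a) (hρ : 0 < ρ) {e : E} (he : ‖e‖ = 1) :
    Filter.Tendsto
      (fun r : ℝ => deriv
        (fun s : ℝ => (a * (max 0 (1 - (‖s • e‖ / ρ) ^ 2)) ^ (1 / m)) ^ m / m) r)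
      (𝓝[<] ρ) (𝓝 (-(2 * a ^ m / (m * ρ)))) := by
  have hlim : Filter.Tendsto (fun r : ℝ => -(2 * a ^ m * r / (m * ρ ^ 2))) (𝓝[<] ρ)
      (𝓝 (-(2 * a ^ m / (m * ρ)))) := by
    have hc : Continuous fun r : ℝ => -(2 * a ^ m * r / (m * ρ ^ 2)) := by fun_prop
    have h := hc.tendsto ρ
    have hval : -(2 * a ^ m * ρ / (m * ρ ^ 2)) = -(2 * a ^ m / (m * ρ)) := by field_simp
    rw [hval] at h
    exact h.mono_left nhdsWithin_le_nhds
  refine hlim.congr' ?_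
  filter_upwards [Ioo_mem_nhdsLT hρ] with r hr
  have hderiv : HasDerivAt (fun s : ℝ => a ^ m * (1 - (s / ρ) ^ 2) / m)
      (-(2 * a ^ m * r / (m * ρ ^ 2))) r := by
    have h := (((((hasDerivAt_id r).div_const ρ).pow 2).const_sub 1).const_mul (a ^ m)).div_const m
    refine h.congr_deriv ?_
    simp only [id_eq, Nat.add_one_sub_one, pow_one, Nat.cast_ofNat]
    field_simp
  refine (hderiv.congr_of_eventuallyEq ?_).deriv.symm
  filter_upwards [Ioo_mem_nhds hr.1 hr.2] with s hs
  have hle : 0 ≤ 1 - (s / ρ) ^ 2 := by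
    have h1 : s / ρ ≤ 1 := (div_le_one hρ).2 hs.2.le
    have h0 : 0 ≤ s / ρ := div_nonneg hs.1.le hρ.le
    exact sub_nonneg.2 (pow_le_one₀ h0 h1)
  rw [norm_smul, he, mul_one, Real.norm_of_nonneg hs.1.le, max_eq_right hle,
    Real.mul_rpow ha (Real.rpow_nonneg hle _), ← Real.rpow_mul hle, one_div_mul_cancel hm,
    Real.rpow_one]

/-- Darcy's law at the free boundary for the Barenblatt–Pattle
solution: for every `t > 0`, the free boundary radius `R` is differentiable at `t`
with `R'(t) = 2/(m r₀ λ(t)^(dm+1))`, and for every unit vector `e`, the radial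
derivative of the pressure `r ↦ (d/dr)(u(r e, t)^m / m)` (defined for
`0 < r < R t`) tends to `−R'(t)` as `r → R(t)⁻`. -/
theorem barenblatt_darcy_law
    (d : ℕ) (hd : 1 ≤ d) (m r₀ : ℝ) (hm : 1 ≤ m) (hr : 0 < r₀)
    (t₀ : ℝ) (ht₀ : t₀ = r₀ ^ 2 * m / (2 * (2 + (d : ℝ) * m)))
    (lam R : ℝ → ℝ)
    (hlam : ∀ t, lam t = (t / t₀) ^ ((1 : ℝ) / (2 + (d : ℝ) * m)))
    (hR : ∀ t, R t = r₀ * lam t)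
    (u : EuclideanSpace ℝ (Fin d) → ℝ → ℝ)
    (hu : ∀ x t, u x t
      = (lam t) ^ (-(d : ℝ)) * (max 0 (1 - (‖x‖ / R t) ^ 2)) ^ (1 / m)) :
    ∀ t : ℝ, 0 < t →
      HasDerivAt R (2 / (m * r₀ * (lam t) ^ ((d : ℝ) * m + 1))) t ∧
      ∀ e : EuclideanSpace ℝ (Fin d), ‖e‖ = 1 →
        Filter.Tendsto (fun r : ℝ => deriv (fun s : ℝ => u (s • e) t ^ m / m) r)
          (𝓝[<] (R t)) (𝓝 (-(2 / (m * r₀ * (lam t) ^ ((d : ℝ) * m + 1))))) := by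
  intro t ht
  have hm0 : 0 < m := one_pos.trans_le hm
  have hk : 0 < 2 + (d : ℝ) * m := by positivity
  have ht₀pos : 0 < t₀ := by rw [ht₀]; positivity
  have hlampos : 0 < lam t := by
    rw [hlam]
    exact Real.rpow_pos_of_pos (div_pos ht ht₀pos) _
  constructor
  · have h := (hasDerivAt_div_rpow_one_div hk ht₀pos ht).const_mul r₀
    rw [← hlam t, show 2 + (d : ℝ) * m - 1 = d * m + 1 by ring] at h
    have hRfun : R = fun s => r₀ * (s / t₀) ^ (1 / (2 + (d : ℝ) * m)) :=
      funext fun s => by rw [hR, hlam]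
    rw [hRfun]
    refine h.congr_deriv ?_
    have hpow : 0 < lam t ^ ((d : ℝ) * m + 1) := Real.rpow_pos_of_pos hlampos _
    rw [ht₀]
    field_simp
  · intro e he
    have hRpos : 0 < R t := by rw [hR]; exact mul_pos hr hlampos
    have h := tendsto_deriv_pressure_nhdsLT hm0.ne'
      (Real.rpow_nonneg hlampos.le (-(d : ℝ))) hRpos he
    simp only [hu]
    convert h using 3
    rw [← Real.rpow_mul hlampos.le, neg_mul, Real.rpow_neg hlampos.le, hR,
      Real.rpow_add_one hlampos.ne']
    have hpow : 0 < lam t ^ ((d : ℝ) * m) := Real.rpow_pos_of_pos hlampos _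
    field_simp
end

section
/- Assume m > 1. For every t > 0 and every unit vector e ∈ ℝ^d, the slope of the Barenblatt–Pattle solution at the free boundary is infinite: the radial derivative (d/dr) u(r e, t), defined for 0 < r < R(t), tends to −∞ as r → R(t)⁻. -/
open Real Topology

theorem one_sub_div_sq_pos {ρ s : ℝ} (hs₀ : 0 < s) (hs : s < ρ) : 0 < 1 - (s / ρ) ^ 2 := by
  have h_lt : s / ρ < 1 := (div_lt_one (hs₀.trans hs)).2 hs
  have h_pos : 0 < s / ρ := div_pos hs₀ (hs₀.trans hs)
  nlinarith

/-- The derivative of the truncated profile `A * (1 - (s / ρ) ^ 2)₊ ^ p` inside its support. -/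
theorem hasDerivAt_truncated_profile {A ρ p r : ℝ} (hr₀ : 0 < r) (hr : r < ρ) :
    HasDerivAt (fun s : ℝ => A * (max 0 (1 - (|s| / ρ) ^ 2)) ^ p)
      (A * (-(2 * r / ρ ^ 2) * p) * (1 - (r / ρ) ^ 2) ^ (p - 1)) r := by
  have hρ : 0 < ρ := hr₀.trans hr
  have h_base : HasDerivAt (fun s : ℝ => 1 - (s / ρ) ^ 2) (-(2 * r / ρ ^ 2)) r := by
    refine ((((hasDerivAt_id r).div_const ρ).pow 2).const_sub 1).congr_deriv ?_
    norm_num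
    field_simp
  refine (((h_base.rpow_const (p := p) (Or.inl (one_sub_div_sq_pos hr₀ hr).ne')).const_mul
    A).congr_of_eventuallyEq ?_).congr_deriv (by ring)
  filter_upwards [Ioo_mem_nhds hr₀ hr] with s hs
  rw [abs_of_pos hs.1, max_eq_right (one_sub_div_sq_pos hs.1 hs.2).le]

/-- For an exponent `p ∈ (0, 1)` the truncated profile has infinite slope at the edge of its
support. -/
theorem tendsto_deriv_truncated_profile_atBot {A ρ p : ℝ} (hA : 0 < A) (hρ : 0 < ρ)
    (hp₀ : 0 < p) (hp₁ : p < 1) :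
    Filter.Tendsto (deriv fun s : ℝ => A * (max 0 (1 - (|s| / ρ) ^ 2)) ^ p)
      (𝓝[<] ρ) Filter.atBot := by
  have h_mem : Set.Ioo 0 ρ ∈ 𝓝[<] ρ := Ioo_mem_nhdsLT hρ
  have h_base : Filter.Tendsto (fun r : ℝ => 1 - (r / ρ) ^ 2) (𝓝[<] ρ) (𝓝[>] 0) := by
    refine tendsto_nhdsWithin_iff.2 ⟨?_, ?_⟩
    · have h_cont : Continuous fun r : ℝ => 1 - (r / ρ) ^ 2 := by fun_prop
      simpa [hρ.ne'] using (h_cont.tendsto ρ).mono_left nhdsWithin_le_nhds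
    · filter_upwards [h_mem] with r hr
      exact one_sub_div_sq_pos hr.1 hr.2
  have h_coeff : Filter.Tendsto (fun r : ℝ => A * (-(2 * r / ρ ^ 2) * p)) (𝓝[<] ρ)
      (𝓝 (A * (-(2 * ρ / ρ ^ 2) * p))) := by
    have h_cont : Continuous fun r : ℝ => A * (-(2 * r / ρ ^ 2) * p) := by fun_prop
    exact (h_cont.tendsto ρ).mono_left nhdsWithin_le_nhds
  have h_neg : A * (-(2 * ρ / ρ ^ 2) * p) < 0 :=
    mul_neg_of_pos_of_neg hA (mul_neg_of_neg_of_pos (neg_neg_of_pos (by positivity)) hp₀)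
  refine (h_coeff.neg_mul_atTop h_neg
    ((tendsto_rpow_neg_nhdsGT_zero (sub_neg.2 hp₁)).comp h_base)).congr' ?_
  filter_upwards [h_mem] with r hr
  exact (hasDerivAt_truncated_profile hr.1 hr.2).deriv.symm

/-- Assume `m > 1`. For every `t > 0` and every unit vector `e`, the
slope of the Barenblatt–Pattle solution at the free boundary is infinite: the radial
derivative `(d/dr) u(r e, t)`, defined for `0 < r < R t`, tends to `−∞` as
`r → R(t)⁻`. -/
theorem barenblatt_slope_infinite_m_gt_one
    (d : ℕ) (hd : 1 ≤ d) (m r₀ : ℝ) (hm : 1 ≤ m) (hm1 : 1 < m) (hr : 0 < r₀)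
    (t₀ : ℝ) (ht₀ : t₀ = r₀ ^ 2 * m / (2 * (2 + (d : ℝ) * m)))
    (lam R : ℝ → ℝ)
    (hlam : ∀ t, lam t = (t / t₀) ^ ((1 : ℝ) / (2 + (d : ℝ) * m)))
    (hR : ∀ t, R t = r₀ * lam t)
    (u : EuclideanSpace ℝ (Fin d) → ℝ → ℝ)
    (hu : ∀ x t, u x t
      = (lam t) ^ (-(d : ℝ)) * (max 0 (1 - (‖x‖ / R t) ^ 2)) ^ (1 / m)) :
    ∀ t : ℝ, 0 < t → ∀ e : EuclideanSpace ℝ (Fin d), ‖e‖ = 1 →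
      Filter.Tendsto (fun r : ℝ => deriv (fun s : ℝ => u (s • e) t) r)
        (𝓝[<] (R t)) Filter.atBot := by
  intro t ht e he
  have hm₀ : 0 < m := by linarith
  have hlam_pos : 0 < lam t := by
    rw [hlam, ht₀]
    positivity
  have hR_pos : 0 < R t := by
    rw [hR]
    positivity
  have h_radial : (fun s : ℝ => u (s • e) t)
      = fun s : ℝ => (lam t) ^ (-(d : ℝ)) * (max 0 (1 - (|s| / R t) ^ 2)) ^ (1 / m) := by
    funext s
    rw [hu, norm_smul, he, mul_one, Real.norm_eq_abs]
  rw [h_radial]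
  exact tendsto_deriv_truncated_profile_atBot (by positivity) hR_pos (by positivity)
    ((div_lt_one hm₀).2 hm1)
end

section
/- Let d = 2. For every t > 0 and every real q with 0 < q < 2m/(3m−2), the square root of the absolute value of the Hessian determinant of the Barenblatt–Pattle solution is q-integrable over the open support: ∫_{‖x‖ < R(t)} |det Hess_x u(x,t)|^{q/2} dx < ∞, where Hess_x u denotes the 2×2 matrix of second spatial partial derivatives of u(·,t), which exists at every point of the open ball {‖x‖ < R(t)}. -/
open Real MeasureTheory

section Profile

variable {E : Type*} [NormedAddCommGroup E] {ρ : ℝ} {x : E}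

lemma one_sub_norm_div_sq_pos (hx : x ∈ Metric.ball (0 : E) ρ) : 0 < 1 - (‖x‖ / ρ) ^ 2 := by
  have h : ‖x‖ < ρ := by simpa using hx
  have hρ : 0 < ρ := (norm_nonneg x).trans_lt h
  have h1 : ‖x‖ / ρ < 1 := (div_lt_one hρ).2 h
  have h0 : 0 ≤ ‖x‖ / ρ := by positivity
  nlinarith

lemma max_one_sub_norm_div_sq (hx : x ∈ Metric.ball (0 : E) ρ) :
    max 0 (1 - (‖x‖ / ρ) ^ 2) = 1 - (‖x‖ / ρ) ^ 2 :=
  max_eq_right (one_sub_norm_div_sq_pos hx).le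

lemma max_rpow_eventuallyEq (p : ℝ) (hx : x ∈ Metric.ball (0 : E) ρ) :
    (fun y : E => (max 0 (1 - (‖y‖ / ρ) ^ 2)) ^ p) =ᶠ[nhds x]
      fun y => (1 - ‖y‖ ^ 2 / ρ ^ 2) ^ p := by
  filter_upwards [Metric.isOpen_ball.mem_nhds hx] with y hy
  rw [max_one_sub_norm_div_sq hy, div_pow]

variable [InnerProductSpace ℝ E]

lemma contDiffAt_max_rpow (p : ℝ) (hx : x ∈ Metric.ball (0 : E) ρ) :
    ContDiffAt ℝ 2 (fun y : E => (max 0 (1 - (‖y‖ / ρ) ^ 2)) ^ p) x := by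
  refine ContDiffAt.congr_of_eventuallyEq ?_ (max_rpow_eventuallyEq p hx)
  have hw := one_sub_norm_div_sq_pos hx
  rw [div_pow] at hw
  exact ContDiffAt.rpow_const_of_ne
    (contDiffAt_const.sub ((contDiff_norm_sq ℝ).contDiffAt.div_const _)) hw.ne'

lemma hasFDerivAt_max_rpow (p : ℝ) (hx : x ∈ Metric.ball (0 : E) ρ) :
    HasFDerivAt (fun y : E => (max 0 (1 - (‖y‖ / ρ) ^ 2)) ^ p)
      ((-2 * p / ρ ^ 2 * (1 - (‖x‖ / ρ) ^ 2) ^ (p - 1)) • innerSL ℝ x) x := by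
  refine HasFDerivAt.congr_of_eventuallyEq ?_ (max_rpow_eventuallyEq p hx)
  have hw := one_sub_norm_div_sq_pos hx
  rw [div_pow] at hw ⊢
  have h := (((hasStrictFDerivAt_norm_sq x).hasFDerivAt.mul_const (ρ ^ 2)⁻¹).const_sub
    1).rpow_const (p := p) (Or.inl (by rw [← div_eq_mul_inv]; exact hw.ne'))
  simp only [← div_eq_mul_inv] at h
  convert h using 1
  ext v
  simp
  ring

lemma fderiv_fderiv_max_rpow (c p : ℝ) (v w : E) (hx : x ∈ Metric.ball (0 : E) ρ) :
    fderiv ℝ (fun y => fderiv ℝ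
      (fun z : E => c * (max 0 (1 - (‖z‖ / ρ) ^ 2)) ^ p) y v) x w =
      -2 * c * p / ρ ^ 2 * (1 - (‖x‖ / ρ) ^ 2) ^ (p - 1) * inner ℝ w v +
      4 * c * p * (p - 1) / ρ ^ 4 * (1 - (‖x‖ / ρ) ^ 2) ^ (p - 2) * inner ℝ x v * inner ℝ x w := by
  have h1 : (fun y => fderiv ℝ
      (fun z : E => c * (max 0 (1 - (‖z‖ / ρ) ^ 2)) ^ p) y v) =ᶠ[nhds x]
      fun y => -2 * c * p / ρ ^ 2 * ((max 0 (1 - (‖y‖ / ρ) ^ 2)) ^ (p - 1) * inner ℝ y v) := by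
    filter_upwards [Metric.isOpen_ball.mem_nhds hx] with y hy
    rw [((hasFDerivAt_max_rpow p hy).const_mul c).fderiv, max_one_sub_norm_div_sq hy]
    simp
    ring
  have h2 : HasFDerivAt (fun y : E => inner ℝ y v) (innerSL ℝ v) x := by
    simpa only [innerSL_apply_apply, real_inner_comm] using! (innerSL ℝ v).hasFDerivAt (x := x)
  have h3 := ((hasFDerivAt_max_rpow (p - 1) hx).mul h2).const_mul (-2 * c * p / ρ ^ 2)
  simp only [Pi.mul_apply] at h3
  rw [h1.fderiv_eq, h3.fderiv,
    max_one_sub_norm_div_sq hx, show p - 1 - 1 = p - 2 by ring]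
  simp [real_inner_comm w v]
  ring

end Profile

lemma integrableOn_one_sub_norm_div_rpow {E : Type*} [NormedAddCommGroup E] [NormedSpace ℝ E]
    [FiniteDimensional ℝ E] [Nontrivial E] [MeasurableSpace E] [BorelSpace E]
    (μ : Measure E) [μ.IsAddHaarMeasure] {ρ s : ℝ} (hρ : 0 < ρ) (hs : -1 < s) :
    IntegrableOn (fun x : E => (1 - ‖x‖ / ρ) ^ s) (Metric.ball 0 ρ) μ := by
  have hind : (Metric.ball (0 : E) ρ).indicator (fun x : E => (1 - ‖x‖ / ρ) ^ s) =
      fun x => (Set.Iio ρ).indicator (fun r => (1 - r / ρ) ^ s) ‖x‖ := by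
    have hball : Metric.ball (0 : E) ρ = (‖·‖) ⁻¹' Set.Iio ρ := by ext; simp
    rw [hball]
    rfl
  rw [← integrable_indicator_iff measurableSet_ball, hind, integrable_fun_norm_addHaar]
  have hI : IntervalIntegrable (fun r : ℝ => (1 - r / ρ) ^ s) volume 0 ρ := by
    have h := ((intervalIntegral.intervalIntegrable_rpow' hs (a := 0) (b := 1)).comp_sub_left
      1).comp_mul_right (c := ρ⁻¹)
    simpa [div_eq_mul_inv, hρ.ne'] using h.symm
  have hJ := hI.continuousOn_mul
    (g := fun r : ℝ => r ^ (Module.finrank ℝ E - 1)) (by fun_prop)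
  rw [intervalIntegrable_iff_integrableOn_Ioo_of_le hρ.le, ← Set.Iio_inter_Ioi, IntegrableOn,
    ← Measure.restrict_restrict measurableSet_Iio, ← IntegrableOn,
    ← integrable_indicator_iff measurableSet_Iio] at hJ
  refine hJ.congr (.of_forall fun r => ?_)
  simp [Set.indicator_apply]

lemma integrableOn_one_sub_norm_div_sq_rpow {E : Type*} [NormedAddCommGroup E]
    [NormedSpace ℝ E] [FiniteDimensional ℝ E] [Nontrivial E] [MeasurableSpace E] [BorelSpace E]
    (μ : Measure E) [μ.IsAddHaarMeasure] {ρ s : ℝ} (hρ : 0 < ρ) (hs : -1 < s) (hs0 : s ≤ 0) :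
    IntegrableOn (fun x : E => (1 - (‖x‖ / ρ) ^ 2) ^ s) (Metric.ball 0 ρ) μ := by
  refine (integrableOn_one_sub_norm_div_rpow μ hρ hs).mono' ?_ ?_
  · refine ContinuousOn.aestronglyMeasurable ?_ measurableSet_ball
    exact ContinuousOn.rpow_const (by fun_prop)
      fun x hx => Or.inl (one_sub_norm_div_sq_pos hx).ne'
  · refine (ae_restrict_iff' measurableSet_ball).2 (.of_forall fun x hx => ?_)
    have hw := one_sub_norm_div_sq_pos hx
    have h1 : ‖x‖ / ρ < 1 := (div_lt_one hρ).2 (by simpa using hx)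
    have h0 : 0 ≤ ‖x‖ / ρ := by positivity
    rw [norm_of_nonneg (rpow_nonneg hw.le _)]
    exact rpow_le_rpow_of_nonpos (by linarith) (by nlinarith) hs0

lemma det_hessian_max_rpow {ρ : ℝ} (c p : ℝ) {x : EuclideanSpace ℝ (Fin 2)}
    (hx : x ∈ Metric.ball 0 ρ) :
    Matrix.det (Matrix.of fun i j : Fin 2 =>
      fderiv ℝ (fun y => fderiv ℝ (fun z : EuclideanSpace ℝ (Fin 2) =>
        c * (max 0 (1 - (‖z‖ / ρ) ^ 2)) ^ p) y
          (EuclideanSpace.single j 1)) x (EuclideanSpace.single i 1)) =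
      (2 * c * p / ρ ^ 2) ^ 2 * (1 - (‖x‖ / ρ) ^ 2) ^ (2 * p - 3) *
        (1 - (2 * p - 1) * (‖x‖ / ρ) ^ 2) := by
  have hw := one_sub_norm_div_sq_pos hx
  have hρ : ρ ≠ 0 := by
    rintro rfl
    simp at hx
  have hn : (‖x‖ / ρ) ^ 2 = (x 0 ^ 2 + x 1 ^ 2) / ρ ^ 2 := by
    rw [div_pow, EuclideanSpace.real_norm_sq_eq, Fin.sum_univ_two]
  simp only [fderiv_fderiv_max_rpow c p _ _ hx, Matrix.det_fin_two, Matrix.of_apply,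
    EuclideanSpace.inner_single_right, PiLp.single_apply]
  have e1 : (1 - (‖x‖ / ρ) ^ 2) ^ (p - 1) =
      (1 - (‖x‖ / ρ) ^ 2) ^ (p - 2) * (1 - (‖x‖ / ρ) ^ 2) := by
    rw [← rpow_add_one hw.ne']; congr 1; ring
  have e2 : (1 - (‖x‖ / ρ) ^ 2) ^ (2 * p - 3) =
      ((1 - (‖x‖ / ρ) ^ 2) ^ (p - 2)) ^ 2 * (1 - (‖x‖ / ρ) ^ 2) := by
    rw [← rpow_natCast (_ ^ (p - 2)), ← rpow_mul hw.le, ← rpow_add_one hw.ne']; congr 1; push_cast; ring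
  rw [e1, e2]
  generalize (1 - (‖x‖ / ρ) ^ 2) ^ (p - 2) = W
  rw [hn]
  simp
  field_simp
  ring

/-- Let `d = 2`. For every `t > 0` and every real `q` with
`0 < q < 2m/(3m−2)`, the square root of the absolute value of the Hessian
determinant of the Barenblatt–Pattle solution is `q`-integrable over the open
support: `∫_{‖x‖ < R t} |det Hess_x u(x,t)|^(q/2) dx < ∞`, where `Hess_x u` is the
`2×2` matrix of second spatial partial derivatives of `u(·,t)`, which exists at
every point of the open ball `{‖x‖ < R t}`. -/
theorem barenblatt_hessian_integrability
    (m r₀ : ℝ) (hm : 1 ≤ m) (hr : 0 < r₀)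
    (t₀ : ℝ) (ht₀ : t₀ = r₀ ^ 2 * m / (2 * (2 + (2 : ℝ) * m)))
    (lam R : ℝ → ℝ)
    (hlam : ∀ t, lam t = (t / t₀) ^ ((1 : ℝ) / (2 + (2 : ℝ) * m)))
    (hR : ∀ t, R t = r₀ * lam t)
    (u : EuclideanSpace ℝ (Fin 2) → ℝ → ℝ)
    (hu : ∀ x t, u x t
      = (lam t) ^ (-(2 : ℝ)) * (max 0 (1 - (‖x‖ / R t) ^ 2)) ^ (1 / m)) :
    ∀ t : ℝ, 0 < t → ∀ q : ℝ, 0 < q → q < 2 * m / (3 * m - 2) →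
      (∀ x ∈ Metric.ball (0 : EuclideanSpace ℝ (Fin 2)) (R t),
        ContDiffAt ℝ 2 (fun y => u y t) x) ∧
      IntegrableOn
        (fun x : EuclideanSpace ℝ (Fin 2) =>
          |Matrix.det (Matrix.of fun i j : Fin 2 =>
            fderiv ℝ (fun y => fderiv ℝ (fun y' => u y' t) y
              (EuclideanSpace.single j 1)) x (EuclideanSpace.single i 1))| ^ (q / 2))
        (Metric.ball (0 : EuclideanSpace ℝ (Fin 2)) (R t)) volume := by
  intro t ht q hq hqm
  have hm0 : 0 < m := by linarith
  have hρ : 0 < R t := by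
    rw [hR, hlam, ht₀]
    positivity
  simp only [hu]
  generalize R t = ρ at hρ
  generalize lam t ^ (-(2 : ℝ)) = c
  refine ⟨fun x hx => contDiffAt_const.mul (contDiffAt_max_rpow _ hx), ?_⟩
  have hp0 : 0 < 1 / m := by positivity
  have hp1 : 1 / m ≤ 1 := (div_le_one hm0).2 hm
  have hs : -1 < (2 * (1 / m) - 3) * (q / 2) := by
    have h3 : 0 < 3 * m - 2 := by linarith
    rw [lt_div_iff₀ h3] at hqm
    have e : (2 * (1 / m) - 3) * (q / 2) = -((q * (3 * m - 2)) / (2 * m)) := by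
      field_simp
      ring
    rw [e, neg_lt_neg_iff, div_lt_one (by positivity)]
    exact hqm
  generalize 1 / m = p at hp0 hp1 hs
  have hs0 : (2 * p - 3) * (q / 2) ≤ 0 := by nlinarith
  refine IntegrableOn.congr_fun (f := fun x : EuclideanSpace ℝ (Fin 2) =>
    |1 - (2 * p - 1) * (‖x‖ / ρ) ^ 2| ^ (q / 2) *
      (|(2 * c * p / ρ ^ 2) ^ 2| ^ (q / 2) *
      (1 - (‖x‖ / ρ) ^ 2) ^ ((2 * p - 3) * (q / 2)))) ?_ (fun x hx => ?_) measurableSet_ball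
  · refine Integrable.bdd_mul (c := 2 ^ (q / 2))
      ((integrableOn_one_sub_norm_div_sq_rpow volume hρ hs hs0).const_mul _) ?_ ?_
    · refine Continuous.aestronglyMeasurable (Continuous.rpow_const (by fun_prop) fun _ => ?_)
      exact Or.inr (by positivity)
    · refine (ae_restrict_iff' measurableSet_ball).2 (.of_forall fun x hx => ?_)
      have hw := one_sub_norm_div_sq_pos hx
      rw [norm_of_nonneg (by positivity)]
      refine rpow_le_rpow (abs_nonneg _) (abs_le.2 ?_) (by positivity)
      constructor <;> nlinarith [sq_nonneg (‖x‖ / ρ)]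
  · have hw := one_sub_norm_div_sq_pos hx
    dsimp only
    rw [det_hessian_max_rpow c p hx, abs_mul, abs_mul, mul_rpow (by positivity) (by positivity),
      mul_rpow (by positivity) (by positivity), abs_of_pos (rpow_pos_of_pos hw _),
      rpow_mul hw.le]
    ring
end
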